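/- Let 𝔞 be an ideal of R, M a finitely generated R-module with M ≠ 𝔞M, and c = cd(𝔞, R). Assume M is 𝔞-relative regular, 𝔞 = (x₁, …, x_c) where x₁, …, x_c form both an M-regular sequence and an R-regular sequence, and let 1 ≤ n ≤ c. Then M/(x₁, …, x_n)M is 𝔞R̄-relative regular over R̄ = R/(x₁, …, x_n). -/

import Mathlib

open CategoryTheory TensorProduct

noncomputable section

universe u

/-- The cohomological dimension `cd(𝔞, M)`: the largest `i` (in `ℕ∞`) such that the local
cohomology module `H^i_𝔞(M)` is nonzero. -/
noncomputable def cohDim {R : Type u} [CommRing R] (a : Ideal R)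
    (M : Type u) [AddCommGroup M] [Module R M] : ℕ∞ :=
  sSup ((fun i : ℕ => (i : ℕ∞)) ''
    {i : ℕ | Nontrivial ((localCohomology a i).obj (ModuleCat.of R M))})

/-- The grade `grade(𝔞, M)`: the least `i` (in `ℕ∞`) such that `Ext^i_R(R/𝔞, M) ≠ 0`. -/
noncomputable def relGrade {R : Type u} [CommRing R] (a : Ideal R)
    (M : Type u) [AddCommGroup M] [Module R M] : ℕ∞ :=
  sInf ((fun i : ℕ => (i : ℕ∞)) ''
    {i : ℕ | Nontrivial (((Ext R (ModuleCat.{u} R) i).obj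
      (Opposite.op (ModuleCat.of R (R ⧸ a)))).obj (ModuleCat.of R M))})

/-- `M` is `𝔞`-relative Cohen-Macaulay: `M = 𝔞M`, or `M ≠ 𝔞M` and `grade(𝔞,M) = cd(𝔞,M)`. -/
def IsRelCM {R : Type u} [CommRing R] (a : Ideal R)
    (M : Type u) [AddCommGroup M] [Module R M] : Prop :=
  a • (⊤ : Submodule R M) = ⊤ ∨
    (a • (⊤ : Submodule R M) ≠ ⊤ ∧ relGrade a M = cohDim a M)

/-- `M` is `𝔞`-relative maximal Cohen-Macaulay: `grade(𝔞,M) = cd(𝔞,R)`. -/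
def IsRelMCM {R : Type u} [CommRing R] (a : Ideal R)
    (M : Type u) [AddCommGroup M] [Module R M] : Prop :=
  relGrade a M = cohDim a R

/-- `M` is `𝔞`-relative Gorenstein: `Ext^i_R(R/𝔞, M) = 0` for all `i ≠ cd(𝔞,R)`. -/
def IsRelGorenstein {R : Type u} [CommRing R] (a : Ideal R)
    (M : Type u) [AddCommGroup M] [Module R M] : Prop :=
  ∀ i : ℕ, (i : ℕ∞) ≠ cohDim a R →
    Subsingleton (((Ext R (ModuleCat.{u} R) i).obj
      (Opposite.op (ModuleCat.of R (R ⧸ a)))).obj (ModuleCat.of R M))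

/-- `M` is `𝔞`-relative regular: `M = 𝔞M`, or `M ≠ 𝔞M` and `𝔞` is generated by a sequence of
length `cd(𝔞,R)` which is both an `M`-regular sequence and an `R`-regular sequence. -/
def IsRelRegular {R : Type u} [CommRing R] (a : Ideal R)
    (M : Type u) [AddCommGroup M] [Module R M] : Prop :=
  a • (⊤ : Submodule R M) = ⊤ ∨
    (a • (⊤ : Submodule R M) ≠ ⊤ ∧ ∃ rs : List R,
      (rs.length : ℕ∞) = cohDim a R ∧ Ideal.span {x | x ∈ rs} = a ∧
      RingTheory.Sequence.IsRegular M rs ∧ RingTheory.Sequence.IsRegular R rs)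

/-- A ring map (given as an algebra) `R → T` is pure if `N → T ⊗[R] N`, `n ↦ 1 ⊗ n`,
is injective for every `R`-module `N`. -/
def IsPureAlgebra (R T : Type u) [CommRing R] [CommRing T] [Algebra R T] : Prop :=
  ∀ (N : Type u) [AddCommGroup N] [Module R N],
    Function.Injective (fun n : N => (1 : T) ⊗ₜ[R] n)

section Bridge
open Opposite
variable {R : Type u} [CommRing R]

abbrev oldF (Y : ModuleCat.{u} R) : ModuleCat.{u} R ⥤ (ModuleCat.{u} R)ᵒᵖ :=
  ((linearYoneda R (ModuleCat.{u} R)).obj Y).rightOp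

abbrev oldK {X : ModuleCat.{u} R} (P : ProjectiveResolution X) (Y : ModuleCat.{u} R) :
    ChainComplex (ModuleCat.{u} R)ᵒᵖ ℕ :=
  ((oldF Y).mapHomologicalComplex _).obj P.complex

abbrev oldE (n : ℕ) (X Y : ModuleCat.{u} R) : ModuleCat.{u} R :=
  ((_root_.Ext R (ModuleCat.{u} R) n).obj (op X)).obj Y

/-- The comparison isomorphism from left derived functors to homology. -/
def oldIso {X : ModuleCat.{u} R} (P : ProjectiveResolution X) (Y : ModuleCat.{u} R) (n : ℕ) :
    ((oldF Y).leftDerived n).obj X ≅ (oldK P Y).homology n :=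
  P.isoLeftDerivedObj (oldF Y) n

lemma oldIso_naturality {X X' : ModuleCat.{u} R} {P : ProjectiveResolution X}
    {P' : ProjectiveResolution X'}
    (Y : ModuleCat.{u} R) (n : ℕ) {g : X' ⟶ X} (φ : ProjectiveResolution.Hom P' P g) :
    ((oldF Y).leftDerived n).map g ≫ (oldIso P Y n).hom = (oldIso P' Y n).hom ≫
      HomologicalComplex.homologyMap (((oldF Y).mapHomologicalComplex _).map φ.hom) n :=
  ProjectiveResolution.isoLeftDerivedObj_hom_naturality g P' P φ.hom
      φ.hom_f_zero_comp_π_f_zero (oldF Y) n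

/-- the surjection from cocycles to old Ext -/
def oldPi {X : ModuleCat.{u} R} (P : ProjectiveResolution X) (Y : ModuleCat.{u} R) (n : ℕ) :
    ((oldK P Y).opcycles n).unop ⟶ oldE n X Y :=
  ((oldIso P Y n).hom ≫ (oldK P Y).homologyι n).unop

def oldIota {X : ModuleCat.{u} R} (P : ProjectiveResolution X) (Y : ModuleCat.{u} R) (n : ℕ) :
    ((oldK P Y).opcycles n).unop ⟶ ModuleCat.of R (P.complex.X n ⟶ Y) :=
  ((oldK P Y).pOpcycles n).unop

def OldRel {X : ModuleCat.{u} R} (P : ProjectiveResolution X) (Y : ModuleCat.{u} R) (n : ℕ)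
    (f : P.complex.X n ⟶ Y) (x : oldE n X Y) : Prop :=
  ∃ z, oldIota P Y n z = f ∧ oldPi P Y n z = x

lemma OldRel.exists_left {X : ModuleCat.{u} R} (P : ProjectiveResolution X) (Y : ModuleCat.{u} R)
    (n : ℕ) (x : oldE n X Y) : ∃ f, OldRel P Y n f x ∧ P.complex.d (n+1) n ≫ f = 0 := by
  have : Epi (oldPi P Y n) := by
    have : Mono ((oldIso P Y n).hom ≫ (oldK P Y).homologyι n) := mono_comp _ _
    exact unop_epi_of_mono _
  obtain ⟨z, hz⟩ := (ModuleCat.epi_iff_surjective _).1 this x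
  refine ⟨_, ⟨z, rfl, hz⟩, ?_⟩
  have := congrArg Quiver.Hom.unop ((oldK P Y).d_pOpcycles (n+1) n)
  exact congrArg (fun (f : ((oldK P Y).opcycles n).unop ⟶ ModuleCat.of R (P.complex.X (n+1) ⟶ Y)) => f z) this

lemma OldRel.exists_right {X : ModuleCat.{u} R} (P : ProjectiveResolution X) (Y : ModuleCat.{u} R)
    (n : ℕ) (f : P.complex.X n ⟶ Y) (hf : P.complex.d (n+1) n ≫ f = 0) :
    ∃ x, OldRel P Y n f x := by
  let φ : ModuleCat.of R R ⟶ ModuleCat.of R (P.complex.X n ⟶ Y) :=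
    ModuleCat.ofHom (LinearMap.toSpanSingleton R _ f)
  let ψ : (oldK P Y).X n ⟶ op (ModuleCat.of R R) := φ.op
  have hψ : (oldK P Y).d (n+1) n ≫ ψ = 0 := by
    apply Quiver.Hom.unop_inj
    ext
    change P.complex.d (n+1) n ≫ ((1 : R) • f) = 0
    simp [hf]
  let χ := (oldK P Y).descOpcycles ψ (n+1) (by simp) hψ
  have h : (oldK P Y).pOpcycles n ≫ χ = ψ := (oldK P Y).p_descOpcycles _ _ _ _
  refine ⟨_, χ.unop (1 : R), ?_, rfl⟩
  have := congrArg Quiver.Hom.unop h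
  have := congrArg (fun (f : ModuleCat.of R R ⟶ ModuleCat.of R (P.complex.X n ⟶ Y)) => f (1:R)) this
  refine this.trans ?_
  change (1 : R) • f = f
  simp

lemma oldIota_inj {X : ModuleCat.{u} R} (P : ProjectiveResolution X) (Y : ModuleCat.{u} R)
    (n : ℕ) : Function.Injective (oldIota P Y n) := by
  rw [← ModuleCat.mono_iff_injective]
  exact unop_mono_of_epi ((oldK P Y).pOpcycles n)

lemma OldRel.eq_zero_iff {X : ModuleCat.{u} R} {P : ProjectiveResolution X} {Y : ModuleCat.{u} R}
    {n : ℕ} {f : P.complex.X (n+1) ⟶ Y} {x : oldE (n+1) X Y} (h : OldRel P Y (n+1) f x) :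
    x = 0 ↔ ∃ g : P.complex.X n ⟶ Y, P.complex.d (n+1) n ≫ g = f := by
  obtain ⟨z, hz, rfl⟩ := h
  let S := ShortComplex.mk ((oldK P Y).homologyι (n+1)) ((oldK P Y).fromOpcycles (n+1) n)
    ((oldK P Y).homologyι_comp_fromOpcycles _ _)
  have hS : S.Exact := S.exact_of_f_is_kernel ((oldK P Y).homologyIsKernel (n+1) n (by simp))
  have hS' := (ShortComplex.moduleCat_exact_iff _).1 hS.unop
  have hd : ((oldK P Y).pOpcycles (n+1) ≫ (oldK P Y).fromOpcycles (n+1) n).unop =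
    ((oldK P Y).d (n+1) n).unop := congrArg Quiver.Hom.unop ((oldK P Y).p_fromOpcycles (n+1) n)
  have hd' : ∀ g : P.complex.X n ⟶ Y, oldIota P Y (n+1) (((oldK P Y).fromOpcycles (n+1) n).unop g)
      = P.complex.d (n+1) n ≫ g := fun g =>
    congrArg (fun (f : ModuleCat.of R (P.complex.X n ⟶ Y) ⟶ ModuleCat.of R (P.complex.X (n+1) ⟶ Y))
      => f g) hd
  have hpi : oldPi P Y (n+1) z = 0 ↔ ((oldK P Y).homologyι (n+1)).unop z = 0 := by
    have inj : Function.Injective (oldIso P Y (n+1)).hom.unop :=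
      (ModuleCat.mono_iff_injective _).1 inferInstance
    have : oldPi P Y (n+1) z = (oldIso P Y (n+1)).hom.unop
      (((oldK P Y).homologyι (n+1)).unop z) := rfl
    rw [this]
    constructor
    · intro h
      apply inj
      rw [h]
      exact (map_zero _).symm
    · intro h
      rw [h]
      exact map_zero _
  rw [hpi]
  constructor
  · intro h
    obtain ⟨g, hg⟩ := hS' z h
    refine ⟨g, (hd' g).symm.trans (Eq.trans ?_ hz)⟩
    exact congrArg _ hg
  · rintro ⟨g, hg⟩
    rw [← hd', ← hz] at hg
    rw [← oldIota_inj P Y _ hg]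
    have := congrArg Quiver.Hom.unop ((oldK P Y).homologyι_comp_fromOpcycles (n+1) n)
    exact congrArg (fun (f : ModuleCat.of R (P.complex.X n ⟶ Y) ⟶ ((oldK P Y).homology (n+1)).unop)
      => f g) this

lemma OldRel.map {X X' : ModuleCat.{u} R} {P : ProjectiveResolution X} {P' : ProjectiveResolution X'}
    {Y : ModuleCat.{u} R} {n : ℕ} {f : P.complex.X n ⟶ Y} {x : oldE n X Y}
    (h : OldRel P Y n f x) {g : X' ⟶ X} (φ : ProjectiveResolution.Hom P' P g) :
    OldRel P' Y n (φ.hom.f n ≫ f) (((_root_.Ext R (ModuleCat.{u} R) n).map g.op).app Y x) := by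
  obtain ⟨z, rfl, rfl⟩ := h
  let Φ : oldK P' Y ⟶ oldK P Y := ((oldF Y).mapHomologicalComplex _).map φ.hom
  refine ⟨(HomologicalComplex.opcyclesMap Φ n).unop z, ?_, ?_⟩
  · have := congrArg Quiver.Hom.unop (HomologicalComplex.p_opcyclesMap Φ n)
    exact congrArg (fun (f : ((oldK P Y).opcycles n).unop ⟶ ModuleCat.of R (P'.complex.X n ⟶ Y))
      => f z) this
  · have h1 := oldIso_naturality Y n φ
    have h2 := HomologicalComplex.homologyι_naturality Φ n
    have h3 : ((oldF Y).leftDerived n).map g ≫ ((oldIso P Y n).hom ≫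
        (oldK P Y).homologyι n) = ((oldIso P' Y n).hom ≫
        (oldK P' Y).homologyι n) ≫ HomologicalComplex.opcyclesMap Φ n := by
      rw [← Category.assoc, h1, Category.assoc, Category.assoc, ← h2]
    have := congrArg Quiver.Hom.unop h3
    exact (congrArg (fun (f : ((oldK P Y).opcycles n).unop ⟶ oldE n X' Y) => f z) this).symm

/-- compare -/
def ExtRel {X : ModuleCat.{u} R} {Y : ModuleCat.{u} R} {n : ℕ}
    (x : oldE n X Y) (x' : Abelian.Ext.{u} X Y n) : Prop :=
  ∃ (P : ProjectiveResolution X) (f : P.complex.X n ⟶ Y) (hf : P.complex.d (n+1) n ≫ f = 0),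
    OldRel P Y n f x ∧ P.extMk f (n+1) rfl hf = x'

lemma ExtRel.exists_right {X : ModuleCat.{u} R} {Y : ModuleCat.{u} R} {n : ℕ}
    (x : oldE n X Y) : ∃ x', ExtRel x x' := by
  let P := projectiveResolution X
  obtain ⟨f, h, hf⟩ := OldRel.exists_left P Y n x
  exact ⟨_, P, f, hf, h, rfl⟩

lemma ExtRel.exists_left {X : ModuleCat.{u} R} {Y : ModuleCat.{u} R} {n : ℕ}
    (x' : Abelian.Ext.{u} X Y n) : ∃ x : oldE n X Y, ExtRel x x' := by
  let P := projectiveResolution X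
  obtain ⟨f, hf, rfl⟩ := P.extMk_surjective x' (n+1) rfl
  obtain ⟨x, hx⟩ := OldRel.exists_right P Y n f hf
  exact ⟨x, P, f, hf, hx, rfl⟩

lemma ExtRel.eq_zero_iff {X : ModuleCat.{u} R} {Y : ModuleCat.{u} R} {n : ℕ}
    {x : oldE (n+1) X Y} {x' : Abelian.Ext.{u} X Y (n+1)} (h : ExtRel x x') :
    x = 0 ↔ x' = 0 := by
  obtain ⟨P, f, hf, h, rfl⟩ := h
  rw [h.eq_zero_iff, P.extMk_eq_zero_iff f _ _ _ n rfl]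

lemma ExtRel.map {X X' : ModuleCat.{u} R} {Y : ModuleCat.{u} R} {n : ℕ}
    {x : oldE n X Y} {x' : Abelian.Ext.{u} X Y n} (h : ExtRel x x') (g : X' ⟶ X) :
    ExtRel (((_root_.Ext R (ModuleCat.{u} R) n).map g.op).app Y x)
      ((Abelian.Ext.mk₀ g).comp x' (zero_add _)) := by
  obtain ⟨P, f, hf, h, rfl⟩ := h
  let P' := projectiveResolution X'
  let φ : ProjectiveResolution.Hom P' P g := ⟨ProjectiveResolution.lift g P' P,
    ProjectiveResolution.lift_commutes_zero g P' P⟩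
  exact ⟨P', _, _, h.map φ, (ProjectiveResolution.mk₀_comp_extMk f _ _ hf φ).symm⟩

end Bridge

section LocCoh
open Opposite
variable {R : Type u} [CommRing R]

/-- The projection `R/I → R/J`. -/
abbrev qmap {I J : Ideal R} (h : I ≤ J) : ModuleCat.of R (R ⧸ I) ⟶ ModuleCat.of R (R ⧸ J) :=
  ModuleCat.ofHom (Submodule.mapQ I J LinearMap.id h)

/-- The evaluated diagram. -/
abbrev lcD (b : Ideal R) (i : ℕ) (Y : ModuleCat.{u} R) : ℕᵒᵖᵒᵖ ⥤ ModuleCat.{u} R :=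
  localCohomology.diagram (localCohomology.idealPowersDiagram b) i ⋙ (evaluation _ _).obj Y

lemma exists_lc_cocone (b : Ideal R) (i : ℕ) (Y : ModuleCat.{u} R) :
    ∃ c : Limits.Cocone (lcD b i Y), Nonempty (Limits.IsColimit c) ∧
      c.pt = (localCohomology b i).obj Y := by
  have := localCohomology.hasColimitDiagram.{u, 0} (localCohomology.idealPowersDiagram b) i
  exact ⟨((evaluation _ _).obj Y).mapCocone (Limits.colimit.cocone _),
    ⟨Limits.isColimitOfPreserves _ (Limits.colimit.isColimit _)⟩, rfl⟩

lemma lc_preserves (F : ℕᵒᵖᵒᵖ ⥤ ModuleCat.{u} R) :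
    Limits.PreservesColimit F (forget (ModuleCat.{u} R)) := by
  have : Limits.PreservesFilteredColimitsOfSize.{0, 0} (forget (ModuleCat.{u} R)) :=
    Limits.preservesFilteredColimitsOfSize_shrink.{0, u, 0, u} _
  infer_instance

lemma lc_subsingleton (b : Ideal R) (i : ℕ) (Y : ModuleCat.{u} R)
    (h : ∀ (k : ℕ) (x : Abelian.Ext.{u} (ModuleCat.of R (R ⧸ b ^ k)) Y (i+1)),
      ∃ (l : ℕ) (hl : k ≤ l),
        (Abelian.Ext.mk₀ (qmap (Ideal.pow_le_pow_right hl))).comp x (zero_add _) = 0) :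
    Subsingleton ((localCohomology b (i+1)).obj Y) := by
  obtain ⟨c, ⟨hc⟩, e⟩ := exists_lc_cocone b (i+1) Y
  have := lc_preserves (lcD b (i+1) Y)
  rw [← e]
  refine subsingleton_of_forall_eq 0 fun y => ?_
  obtain ⟨k, x, rfl⟩ := Limits.Concrete.isColimit_exists_rep _ hc y
  obtain ⟨x', hx⟩ := ExtRel.exists_right (R := R) x
  obtain ⟨l, hl, h0⟩ := h k.unop.unop x'
  have h1 := (hx.map (qmap (Ideal.pow_le_pow_right hl))).eq_zero_iff.2 h0
  let w : k ⟶ op (op l) := (homOfLE hl).op.op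
  rw [← c.w w]
  change c.ι.app _ ((lcD b (i+1) Y).map w x) = 0
  have : (lcD b (i+1) Y).map w x = 0 := h1
  rw [this]
  exact map_zero _

lemma lc_nontrivial (b : Ideal R) (i : ℕ) (Y : ModuleCat.{u} R) (k : ℕ)
    (x : Abelian.Ext.{u} (ModuleCat.of R (R ⧸ b ^ k)) Y (i+1))
    (h : ∀ (l : ℕ) (hl : k ≤ l),
        (Abelian.Ext.mk₀ (qmap (Ideal.pow_le_pow_right hl))).comp x (zero_add _) ≠ 0) :
    Nontrivial ((localCohomology b (i+1)).obj Y) := by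
  obtain ⟨c, ⟨hc⟩, e⟩ := exists_lc_cocone b (i+1) Y
  have := lc_preserves (lcD b (i+1) Y)
  rw [← e]
  obtain ⟨x', hx⟩ := ExtRel.exists_left (R := R) x
  let x'' : (lcD b (i+1) Y).obj (op (op k)) := x'
  refine ⟨c.ι.app (op (op k)) x'', 0, fun h0 => ?_⟩
  have h0' : c.ι.app (op (op k)) x'' = c.ι.app (op (op k)) 0 := h0.trans (map_zero _).symm
  obtain ⟨l, f, g, hfg⟩ := (Limits.Concrete.isColimit_rep_eq_iff_exists _ hc _ _).1 h0'
  have hl : k ≤ l.unop.unop := leOfHom f.unop.unop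
  refine h _ hl ((hx.map (qmap (Ideal.pow_le_pow_right hl))).eq_zero_iff.1 ?_)
  exact hfg.trans (map_zero _)

end LocCoh

section Alg
open RingTheory.Sequence
open scoped Pointwise
variable {R : Type u} [CommRing R]

lemma pd_quot (rs : List R) : ∀ (N : ModuleCat.{u} R) (n : ℕ) [HasProjectiveDimensionLT N n],
    IsWeaklyRegular N rs → HasProjectiveDimensionLT
      (ModuleCat.of R (N ⧸ Ideal.ofList rs • (⊤ : Submodule R N))) (n + rs.length) := by
  induction rs with
  | nil =>
    intro N n _ _
    have e : (N ⧸ Ideal.ofList ([] : List R) • (⊤ : Submodule R N)) ≃ₗ[R] N :=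
      Submodule.quotEquivOfEqBot _ (by simp)
    exact hasProjectiveDimensionLT_of_iso e.symm.toModuleIso n
  | cons x rs ih =>
    intro N n _ h
    rw [isWeaklyRegular_cons_iff] at h
    have h1 : HasProjectiveDimensionLT (ModuleCat.of R (QuotSMulTop x N)) (n+1) := by
      have hS := h.1.smulShortComplex_shortExact
      exact hS.hasProjectiveDimensionLT_X₃ n ‹_›
        (hasProjectiveDimensionLT_of_ge N n (n + 1) (Nat.le_add_right _ 1))
    have h2 := ih (ModuleCat.of R (QuotSMulTop x N)) (n+1) h.2
    have e := (Submodule.quotOfListConsSMulTopEquivQuotSMulTopInner N x rs)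
    have h3 := hasProjectiveDimensionLT_of_iso e.symm.toModuleIso (n + 1 + rs.length)
    rwa [List.length_cons, Nat.add_comm rs.length 1, ← Nat.add_assoc]

lemma ext_top_nontrivial [IsNoetherianRing R] (K : ModuleCat.{u} R) [Module.Finite R K]
    (rs : List R) : ∀ (N : ModuleCat.{u} R) [Module.Finite R N],
    (∀ r ∈ rs, r ∈ Module.annihilator R K) → IsRegular N rs →
    Nontrivial (K →ₗ[R] (N ⧸ Ideal.ofList rs • (⊤ : Submodule R N))) →
    Nontrivial (Abelian.Ext.{u} K N rs.length) := by
  induction rs with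
  | nil =>
    intro N _ _ _ h
    have e : (N ⧸ Ideal.ofList ([] : List R) • (⊤ : Submodule R N)) ≃ₗ[R] N :=
      Submodule.quotEquivOfEqBot _ (by simp)
    have : Nontrivial (K →ₗ[R] N) := (LinearEquiv.congrRight e).symm.toEquiv.nontrivial
    exact (Abelian.Ext.addEquiv₀.trans ModuleCat.homAddEquiv).toEquiv.nontrivial
  | cons x rs ih =>
    intro N _ hr hreg h
    have hle : Ideal.ofList (x :: rs) ≤ Module.annihilator R K := Ideal.span_le.2 hr
    have hsub : Subsingleton (Abelian.Ext.{u} K N rs.length) := by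
      refine ModuleCat.subsingleton_ext_of_exists_isRegular (Ideal.ofList (x :: rs)) K ?_ N
        hreg.top_ne_smul.symm.lt_top (x :: rs) (fun r hr => Ideal.subset_span hr) hreg _ (by simp)
      rw [Module.support_eq_zeroLocus]
      exact PrimeSpectrum.zeroLocus_anti_mono hle
    rw [isRegular_cons_iff] at hreg
    have e := (Submodule.quotOfListConsSMulTopEquivQuotSMulTopInner N x rs)
    have h1 : Nontrivial (Abelian.Ext.{u} K (ModuleCat.of R (QuotSMulTop x N)) rs.length) := by
      refine ih (ModuleCat.of R (QuotSMulTop x N)) (fun r h => hr r (List.mem_cons_of_mem _ h))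
        hreg.2 ?_
      exact (LinearEquiv.congrRight e).symm.toEquiv.nontrivial
    have hS := hreg.1.smulShortComplex_shortExact
    by_contra hnt
    have hz : Subsingleton (Abelian.Ext.{u} K N (rs.length + 1)) :=
      not_nontrivial_iff_subsingleton.1 hnt
    have zero1 := AddCommGrpCat.isZero_of_iff_subsingleton.mpr hsub
    have zero2 := AddCommGrpCat.isZero_of_iff_subsingleton.mpr hz
    have := AddCommGrpCat.subsingleton_of_isZero <| ShortComplex.Exact.isZero_of_both_zeros
        ((Abelian.Ext.covariant_sequence_exact₃' K hS) rs.length (rs.length + 1) rfl)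
        (zero1.eq_zero_of_src _) (zero2.eq_zero_of_tgt _)
    exact not_subsingleton_iff_nontrivial.2 h1 this

lemma ext_pullback_ne_zero [IsNoetherianRing R] (rs : List R) (hreg : IsRegular R rs)
    (i : ℕ) (hi : i + 1 = rs.length) (k l : ℕ) (hl : k ≤ l)
    (x : Abelian.Ext.{u} (ModuleCat.of R (R ⧸ Ideal.ofList rs ^ k)) (ModuleCat.of R R) (i+1))
    (hx : (Abelian.Ext.mk₀ (qmap (Ideal.pow_le_pow_right hl))).comp x (zero_add _) = 0) :
    x = 0 := by
  let f : (R ⧸ Ideal.ofList rs ^ l) →ₗ[R] (R ⧸ Ideal.ofList rs ^ k) :=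
    Submodule.mapQ _ _ LinearMap.id (Ideal.pow_le_pow_right hl)
  have hf : Function.Surjective f := by
    intro y
    obtain ⟨y, rfl⟩ := Submodule.mkQ_surjective _ y
    exact ⟨Submodule.mkQ _ y, rfl⟩
  have hS := LinearMap.shortExact_shortComplexKer hf
  obtain ⟨y, hy⟩ := Abelian.Ext.contravariant_sequence_exact₃ hS (ModuleCat.of R R) x hx
    (n₀ := i) (by omega)
  have hsub : Subsingleton (Abelian.Ext.{u} f.shortComplexKer.X₁ (ModuleCat.of R R) i) := by
    have : Module.Finite R f.shortComplexKer.X₁ := by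
      change Module.Finite R (LinearMap.ker f)
      infer_instance
    refine ModuleCat.subsingleton_ext_of_exists_isRegular (Ideal.ofList rs) _ ?_ _
        hreg.top_ne_smul.symm.lt_top rs (fun r hr => Ideal.subset_span hr) hreg _ (by omega)
    rw [Module.support_eq_zeroLocus, PrimeSpectrum.zeroLocus_subset_zeroLocus_iff]
    intro r hr
    refine ⟨l, ?_⟩
    rw [Module.mem_annihilator]
    rintro ⟨y, hy⟩
    apply Subtype.ext
    obtain ⟨y, rfl⟩ := Submodule.mkQ_surjective _ y
    change Submodule.mkQ _ (r ^ l • y) = 0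
    rw [Submodule.mkQ_apply, Submodule.Quotient.mk_eq_zero]
    exact Ideal.mul_mem_right _ _ (Ideal.pow_mem_pow hr l)
  rw [← hy, Subsingleton.elim y 0, Abelian.Ext.comp_zero]

lemma wr_ext (rs : List R) : ∀ {A B C : Type u} [AddCommGroup A] [AddCommGroup B] [AddCommGroup C]
    [Module R A] [Module R B] [Module R C] (f : A →ₗ[R] B) (g : B →ₗ[R] C),
    Function.Injective f → Function.Exact f g → Function.Surjective g →
    IsWeaklyRegular A rs → IsWeaklyRegular C rs → IsWeaklyRegular B rs := by
  induction rs with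
  | nil => intros; exact IsWeaklyRegular.nil _ _
  | cons r rs ih =>
    intro A B C _ _ _ _ _ _ f g hf hfg hg hA hC
    rw [isWeaklyRegular_cons_iff] at hA hC ⊢
    refine ⟨?_, ih (QuotSMulTop.map r f) (QuotSMulTop.map r g) ?_
      (QuotSMulTop.map_exact r hfg hg) (QuotSMulTop.map_surjective r hg) hA.2 hC.2⟩
    · rw [isSMulRegular_iff_right_eq_zero_of_smul]
      intro b hb
      have h1 : g b = 0 := by
        refine isSMulRegular_iff_right_eq_zero_of_smul.1 hC.1 _ ?_
        rw [← map_smul, hb, map_zero]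
      obtain ⟨a, rfl⟩ := (hfg b).1 h1
      rw [← map_smul] at hb
      have := hf (hb.trans (map_zero f).symm)
      rw [isSMulRegular_iff_right_eq_zero_of_smul.1 hA.1 _ this, map_zero]
    · rw [injective_iff_map_eq_zero]
      intro q hq
      obtain ⟨a, rfl⟩ := Submodule.mkQ_surjective _ q
      change Submodule.mkQ _ (f a) = 0 at hq
      rw [Submodule.mkQ_apply, Submodule.Quotient.mk_eq_zero,
        Submodule.mem_smul_pointwise_iff_exists] at hq
      obtain ⟨b, -, hb⟩ := hq
      have h1 : g b = 0 := by
        refine isSMulRegular_iff_right_eq_zero_of_smul.1 hC.1 _ ?_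
        rw [← map_smul, hb, hfg.apply_apply_eq_zero]
      obtain ⟨a', rfl⟩ := (hfg b).1 h1
      rw [← map_smul] at hb
      rw [← hf hb, Submodule.mkQ_apply, Submodule.Quotient.mk_eq_zero]
      exact Submodule.smul_mem_pointwise_smul _ _ _ trivial

lemma wr_pow_head (x : R) (rs : List R) (M : Type u) [AddCommGroup M] [Module R M]
    (hx : IsSMulRegular M x) (h : IsWeaklyRegular (QuotSMulTop x M) rs) (k : ℕ) :
    IsWeaklyRegular (QuotSMulTop (x ^ k) M) rs := by
  induction k with
  | zero =>
    have : Subsingleton (QuotSMulTop (x ^ 0) M) := by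
      rw [Submodule.Quotient.subsingleton_iff]
      simp
    refine ⟨fun i hi => ?_⟩
    intro a b _
    exact Subsingleton.elim _ _
  | succ k ih =>
    have mm : ∀ (j : ℕ) (m : M), m ∈ (x ^ j) • (⊤ : Submodule R M) ↔ ∃ m', x ^ j • m' = m := by
      intro j m
      simp [Submodule.mem_smul_pointwise_iff_exists]
    have mm1 : ∀ (m : M), m ∈ x • (⊤ : Submodule R M) ↔ ∃ m', x • m' = m := by
      intro m
      simp [Submodule.mem_smul_pointwise_iff_exists]
    have h1 : (x ^ k) • (⊤ : Submodule R M) ≤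
        ((x ^ (k+1)) • (⊤ : Submodule R M)).comap (LinearMap.lsmul R M x) := by
      intro m hm
      obtain ⟨m', rfl⟩ := (mm _ _).1 hm
      exact (mm _ _).2 ⟨m', by rw [pow_succ', mul_smul]; rfl⟩
    have h2 : (x ^ (k+1)) • (⊤ : Submodule R M) ≤
        (x • (⊤ : Submodule R M)).comap LinearMap.id := by
      intro m hm
      obtain ⟨m', rfl⟩ := (mm _ _).1 hm
      exact (mm1 _).2 ⟨x ^ k • m', by simp [pow_succ', mul_smul]⟩
    refine wr_ext rs (Submodule.mapQ _ _ (LinearMap.lsmul R M x) h1)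
      (Submodule.mapQ _ _ LinearMap.id h2) ?_ ?_ ?_ ih h
    · rw [injective_iff_map_eq_zero]
      intro q hq
      obtain ⟨m, rfl⟩ := Submodule.mkQ_surjective _ q
      change Submodule.mkQ _ (x • m) = 0 at hq
      rw [Submodule.mkQ_apply, Submodule.Quotient.mk_eq_zero, mm] at hq
      obtain ⟨m', hm⟩ := hq
      rw [pow_succ', mul_smul] at hm
      rw [Submodule.mkQ_apply, Submodule.Quotient.mk_eq_zero, mm]
      exact ⟨m', hx hm⟩
    · intro q
      obtain ⟨m, rfl⟩ := Submodule.mkQ_surjective _ q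
      constructor
      · intro hq
        change Submodule.mkQ _ m = 0 at hq
        rw [Submodule.mkQ_apply, Submodule.Quotient.mk_eq_zero, mm1] at hq
        obtain ⟨m', rfl⟩ := hq
        exact ⟨Submodule.mkQ _ m', rfl⟩
      · rintro ⟨q, hq⟩
        obtain ⟨m', rfl⟩ := Submodule.mkQ_surjective _ q
        rw [← hq]
        change Submodule.mkQ _ (x • m') = 0
        rw [Submodule.mkQ_apply, Submodule.Quotient.mk_eq_zero, mm1]
        exact ⟨m', rfl⟩
    · intro q
      obtain ⟨m, rfl⟩ := Submodule.mkQ_surjective _ q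
      exact ⟨Submodule.mkQ _ m, rfl⟩

lemma wr_pow (k : ℕ) (rs : List R) : ∀ (M : Type u) [AddCommGroup M] [Module R M],
    IsWeaklyRegular M rs → IsWeaklyRegular M (rs.map (fun z : R => z ^ k)) := by
  induction rs with
  | nil => intros; exact IsWeaklyRegular.nil _ _
  | cons r rs ih =>
    intro M _ _ h
    rw [isWeaklyRegular_cons_iff] at h
    rw [List.map_cons, isWeaklyRegular_cons_iff]
    exact ⟨h.1.pow k, ih _ (wr_pow_head r rs M h.1 h.2 k)⟩

lemma cohDim_eq [IsNoetherianRing R] (rs : List R) (hreg : IsRegular R rs) :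
    cohDim (Ideal.ofList rs) R = rs.length := by
  apply le_antisymm
  · refine sSup_le ?_
    rintro _ ⟨j, hj, rfl⟩
    by_contra hlt
    have hlt : rs.length < j := by simpa using hlt
    obtain ⟨i, rfl⟩ : ∃ i, j = i + 1 := ⟨j - 1, by omega⟩
    refine not_subsingleton_iff_nontrivial.2 hj (lc_subsingleton _ _ _ fun k x => ?_)
    let J : Ideal R := Ideal.ofList (rs.map (fun z : R => z ^ k))
    have hJk : J ≤ Ideal.ofList rs ^ k := by
      refine Ideal.span_le.2 fun y hy => ?_
      obtain ⟨z, hz, rfl⟩ := List.mem_map.1 hy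
      have hz2 : z ∈ Ideal.ofList rs := Ideal.subset_span hz
      exact Ideal.pow_mem_pow hz2 k
    have hrad : Ideal.ofList rs ≤ J.radical := by
      refine Ideal.span_le.2 fun y hy => ?_
      refine ⟨k, ?_⟩
      have hyk : y ^ k ∈ rs.map (fun z : R => z ^ k) := List.mem_map.2 ⟨y, hy, rfl⟩
      exact Ideal.subset_span hyk
    obtain ⟨l, hl⟩ := Ideal.exists_pow_le_of_le_radical_of_fg hrad
      (IsNoetherian.noetherian (Ideal.ofList rs))
    have hJl : Ideal.ofList rs ^ (max k l) ≤ J :=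
      (Ideal.pow_le_pow_right (le_max_right k l)).trans hl
    have hpd : HasProjectiveDimensionLT (ModuleCat.of R (R ⧸ J)) (1 + rs.length) := by
      have := pd_quot (rs.map (fun z : R => z ^ k)) (ModuleCat.of R R) 1 (wr_pow k rs R hreg.1)
      rw [List.length_map] at this
      have e : (R ⧸ J • (⊤ : Submodule R R)) ≃ₗ[R] R ⧸ J :=
        Submodule.quotEquivOfEq _ _ (by simp)
      exact hasProjectiveDimensionLT_of_iso e.toModuleIso _
    have hsub := HasProjectiveDimensionLT.subsingleton (ModuleCat.of R (R ⧸ J))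
      (1 + rs.length) (i + 1) (by omega) (ModuleCat.of R R)
    refine ⟨max k l, le_max_left _ _, ?_⟩
    have hcomp : qmap (Ideal.pow_le_pow_right (I := Ideal.ofList rs) (le_max_left k l)) =
        qmap hJl ≫ qmap hJk := by
      ext
      rfl
    rw [hcomp, ← Abelian.Ext.mk₀_comp_mk₀_assoc,
      Subsingleton.elim ((Abelian.Ext.mk₀ (qmap hJk)).comp x (zero_add _)) 0,
      Abelian.Ext.comp_zero]
  · rcases h : rs.length with _ | i
    · simp
    · refine le_sSup ⟨i + 1, ?_, rfl⟩
      have hnt : Nontrivial (Abelian.Ext.{u} (ModuleCat.of R (R ⧸ Ideal.ofList rs ^ 1))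
          (ModuleCat.of R R) rs.length) := by
        refine ext_top_nontrivial _ rs (ModuleCat.of R R) (fun r hr => ?_) hreg ?_
        · change r ∈ Module.annihilator R (R ⧸ Ideal.ofList rs ^ 1)
          rw [Ideal.annihilator_quotient, pow_one]
          exact Ideal.subset_span hr
        · have e : (R ⧸ Ideal.ofList rs ^ 1) ≃ₗ[R] (R ⧸ Ideal.ofList rs • (⊤ : Submodule R R)) :=
            Submodule.quotEquivOfEq _ _ (by simp)
          have : Nontrivial (R ⧸ Ideal.ofList rs • (⊤ : Submodule R R)) :=
            hreg.quot_ofList_smul_nontrivial ⊤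
          refine ⟨e.toLinearMap, 0, fun h0 => ?_⟩
          obtain ⟨q, hq⟩ := exists_ne (0 : R ⧸ Ideal.ofList rs • (⊤ : Submodule R R))
          apply hq
          rw [← e.apply_symm_apply q]
          exact congrArg (fun f : _ →ₗ[R] _ => f (e.symm q)) h0
      rw [h] at hnt
      obtain ⟨x, hx⟩ := exists_ne (0 : Abelian.Ext.{u} (ModuleCat.of R (R ⧸ Ideal.ofList rs ^ 1))
          (ModuleCat.of R R) (i + 1))
      exact lc_nontrivial _ _ _ 1 x fun l hl h0 =>
        hx (ext_pullback_ne_zero rs hreg i h.symm 1 l hl x h0)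

end Alg

theorem stmt19 {R : Type u} [CommRing R] [IsNoetherianRing R]
    (a : Ideal R) (M : Type u) [AddCommGroup M] [Module R M] [Module.Finite R M]
    (hM : a • (⊤ : Submodule R M) ≠ ⊤)
    (hMreg : IsRelRegular a M) (rs : List R)
    (hlen : (rs.length : ℕ∞) = cohDim a R) (hspan : Ideal.span {x | x ∈ rs} = a)
    (hregM : RingTheory.Sequence.IsRegular M rs)
    (hregR : RingTheory.Sequence.IsRegular R rs)
    (n : ℕ) (hn1 : 1 ≤ n) (hn2 : n ≤ rs.length) :
    IsRelRegular (a.map (Ideal.Quotient.mk (Ideal.span {x | x ∈ rs.take n})))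
      (M ⧸ ((Ideal.span {x | x ∈ rs.take n}) • (⊤ : Submodule R M))) := by
  by_cases h : (a.map (Ideal.Quotient.mk (Ideal.span {x | x ∈ rs.take n}))) •
      (⊤ : Submodule (R ⧸ Ideal.span {x | x ∈ rs.take n})
        (M ⧸ ((Ideal.span {x | x ∈ rs.take n}) • (⊤ : Submodule R M)))) = ⊤
  · exact Or.inl h
  have ha : a = Ideal.ofList (rs.take n) ⊔ Ideal.ofList (rs.drop n) := by
    rw [← Ideal.ofList_append, List.take_append_drop]
    exact hspan.symm
  have hspan' : Ideal.ofList ((rs.drop n).map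
      (Ideal.Quotient.mk (Ideal.span {x | x ∈ rs.take n}))) =
      a.map (Ideal.Quotient.mk (Ideal.span {x | x ∈ rs.take n})) := by
    rw [← Ideal.map_ofList, ha, Ideal.map_sup]
    have : Ideal.map (Ideal.Quotient.mk (Ideal.span {x | x ∈ rs.take n}))
        (Ideal.ofList (rs.take n)) = ⊥ := Ideal.map_quotient_self _
    rw [this, bot_sup_eq]
  have hMbar : RingTheory.Sequence.IsRegular
      (M ⧸ ((Ideal.span {x | x ∈ rs.take n}) • (⊤ : Submodule R M)))
      ((rs.drop n).map (Ideal.Quotient.mk (Ideal.span {x | x ∈ rs.take n}))) := by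
    refine ⟨?_, ?_⟩
    · have h1 := hregM.1
      rw [← List.take_append_drop n rs] at h1
      exact ((RingTheory.Sequence.isWeaklyRegular_append_iff' M (rs.take n) (rs.drop n)).1 h1).2
    · rw [hspan']
      exact fun h' => h h'.symm
  have hRbar : RingTheory.Sequence.IsRegular (R ⧸ Ideal.span {x | x ∈ rs.take n})
      ((rs.drop n).map (Ideal.Quotient.mk (Ideal.span {x | x ∈ rs.take n}))) := by
    refine ⟨?_, ?_⟩
    · have h1 := hregR.1
      rw [← List.take_append_drop n rs] at h1
      have h2 := ((RingTheory.Sequence.isWeaklyRegular_append_iff R (rs.take n)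
        (rs.drop n)).1 h1).2
      let e : (R ⧸ Ideal.ofList (rs.take n) • (⊤ : Submodule R R)) ≃ₗ[R]
          (R ⧸ Ideal.span {x | x ∈ rs.take n}) :=
        Submodule.quotEquivOfEq _ _ (by simp [Ideal.ofList])
      have h3 := (e.isWeaklyRegular_congr (rs.drop n)).1 h2
      exact (RingTheory.Sequence.isWeaklyRegular_map_algebraMap_iff
        (R ⧸ Ideal.span {x | x ∈ rs.take n}) (R ⧸ Ideal.span {x | x ∈ rs.take n})
        (rs.drop n)).2 h3
    · rw [hspan']
      intro h'
      have ht : a.map (Ideal.Quotient.mk (Ideal.span {x | x ∈ rs.take n})) = ⊤ := by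
        simpa using h'.symm
      have hle : Ideal.span {x | x ∈ rs.take n} ≤ a := by
        rw [ha]
        exact le_sup_left
      have hc := congrArg (Ideal.comap (Ideal.Quotient.mk (Ideal.span {x | x ∈ rs.take n}))) ht
      rw [Ideal.comap_map_of_surjective _ Ideal.Quotient.mk_surjective, ← RingHom.ker_eq_comap_bot,
        Ideal.mk_ker, sup_eq_left.2 hle, Ideal.comap_top] at hc
      apply hregR.top_ne_smul
      have : Ideal.ofList rs = a := hspan
      rw [this, hc]
      simp
  refine Or.inr ⟨h, (rs.drop n).map (Ideal.Quotient.mk _), ?_, hspan', hMbar, hRbar⟩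
  rw [← hspan', cohDim_eq _ hRbar]

end
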